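/- The Hermite–Charlier bilinear identity ∑_{n≥0} Hₙᵃ(x) Cₙᵃ(k) / (aⁿ n!) = e^{−a/2 − x} Hₖᵃ(x + 2a) / aᵏ holds for all real x, all k ∈ ℕ, and a > 0, where the series converges in L²(ℝ, N(0,a)). -/

import Mathlib

/-- The scaled Hermite polynomial `Hₙᵃ(x) = a^{n/2} Hₙ(x/√a)`, where `Hₙ` is the
probabilists' Hermite polynomial `Hₙ(x) = (−1)ⁿ e^{x²/2} (d/dx)ⁿ e^{−x²/2}`. -/
noncomputable def hermiteScaled (a : ℝ) (n : ℕ) (x : ℝ) : ℝ :=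
  Real.sqrt a ^ n * Polynomial.aeval (x / Real.sqrt a) (Polynomial.hermite n)

/-- The Charlier polynomial with parameter `a`. -/
noncomputable def charlier (a : ℝ) (n : ℕ) (x : ℝ) : ℝ :=
  a ^ n * ∑ j ∈ Finset.range (n + 1),
    (-1 : ℝ) ^ (n - j) * (n.choose j : ℝ) * (∏ i ∈ Finset.range j, (x - (i : ℝ))) / a ^ j

open Polynomial in
/-- The Hermite polynomials form an Appell sequence: Taylor shift is a binomial sum. -/
theorem hermite_map_comp_X_add_C {R : Type*} [CommRing R] (s : R) (k : ℕ) :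
    ((hermite k).map (Int.castRingHom R)).comp (X + C s) =
      ∑ j ∈ Finset.range (k + 1),
        (k.choose j : R[X]) * (C s ^ (k - j) * (hermite j).map (Int.castRingHom R)) := by
  induction k with
  | zero => simp
  | succ k ih =>
    rw [Finset.sum_choose_succ_mul
      (fun j m => C s ^ m * (hermite j).map (Int.castRingHom R)) k]
    have hd := congrArg derivative ih
    rw [derivative_comp] at hd
    simp only [derivative_add, derivative_X, derivative_C, add_zero, one_mul] at hd
    have hs : ∑ j ∈ Finset.range (k + 1), (k.choose j : R[X]) *
          (C s ^ (k + 1 - j) * (hermite j).map (Int.castRingHom R)) =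
        C s * ∑ j ∈ Finset.range (k + 1),
          (k.choose j : R[X]) * (C s ^ (k - j) * (hermite j).map (Int.castRingHom R)) := by
      rw [Finset.mul_sum]
      refine Finset.sum_congr rfl fun j hj => ?_
      rw [Nat.succ_sub (Nat.lt_succ_iff.mp (Finset.mem_range.mp hj)), pow_succ]
      ring
    have hx : ∑ j ∈ Finset.range (k + 1), (k.choose j : R[X]) *
          (C s ^ (k - j) * (hermite (j + 1)).map (Int.castRingHom R)) =
        X * (∑ j ∈ Finset.range (k + 1),
          (k.choose j : R[X]) * (C s ^ (k - j) * (hermite j).map (Int.castRingHom R))) -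
        derivative (∑ j ∈ Finset.range (k + 1),
          (k.choose j : R[X]) * (C s ^ (k - j) * (hermite j).map (Int.castRingHom R))) := by
      rw [Finset.mul_sum, derivative_sum, ← Finset.sum_sub_distrib]
      refine Finset.sum_congr rfl fun j _ => ?_
      rw [hermite_succ, ← C_pow, derivative_natCast_mul, derivative_C_mul, Polynomial.map_sub,
        Polynomial.map_mul, map_X, derivative_map]
      ring
    rw [hs, hx, ← hd, ← ih, hermite_succ, Polynomial.map_sub, Polynomial.map_mul, map_X, sub_comp,
      mul_comp, X_comp, derivative_map]
    ring

theorem aeval_hermite_add {R : Type*} [CommRing R] (s y : R) (k : ℕ) :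
    Polynomial.aeval (y + s) (Polynomial.hermite k) =
      ∑ j ∈ Finset.range (k + 1),
        (k.choose j : R) * (s ^ (k - j) * Polynomial.aeval y (Polynomial.hermite j)) := by
  have h := congrArg (Polynomial.eval y) (hermite_map_comp_X_add_C s k)
  simpa [Polynomial.eval_finsetSum, Polynomial.aeval_def, Polynomial.eval_map] using h

/-- The `j`-th derivative in `t` of the generating function `exp (y s t - s² t² / 2)`. -/
noncomputable def hermiteGen (s y : ℂ) (j : ℕ) (t : ℂ) : ℂ :=
  s ^ j * Polynomial.aeval (y - s * t) (Polynomial.hermite j) *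
    Complex.exp (y * s * t - s ^ 2 * t ^ 2 / 2)

theorem hasDerivAt_hermiteGen (s y : ℂ) (j : ℕ) (t : ℂ) :
    HasDerivAt (hermiteGen s y j) (hermiteGen s y (j + 1) t) t := by
  have h₁ : HasDerivAt (fun t : ℂ => y - s * t) (-s) t := by
    simpa using ((hasDerivAt_id t).const_mul s).const_sub y
  have h₂ : HasDerivAt (fun t : ℂ => y * s * t - s ^ 2 * t ^ 2 / 2) (y * s - s ^ 2 * t) t := by
    have h₃ := ((hasDerivAt_id t).const_mul (y * s)).sub
      ((((hasDerivAt_id t).pow 2).const_mul (s ^ 2)).div_const 2)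
    convert! h₃ using 1
    simp only [id, Nat.cast_ofNat]
    ring
  have h := ((((Polynomial.hermite j).hasDerivAt_aeval (y - s * t)).comp t h₁).const_mul
    (s ^ j)).mul h₂.cexp
  refine h.congr_deriv ?_
  simp only [hermiteGen, Polynomial.hermite_succ, map_sub, map_mul, Polynomial.aeval_X,
    Function.comp_apply]
  ring

theorem iteratedDeriv_hermiteGen (s y : ℂ) (j m : ℕ) :
    iteratedDeriv m (hermiteGen s y j) = hermiteGen s y (m + j) := by
  induction m generalizing j with
  | zero => simp
  | succ m ih =>
    rw [iteratedDeriv_succ, ih]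
    ext t
    rw [(hasDerivAt_hermiteGen s y (m + j) t).deriv, add_right_comm]

theorem hasSum_hermite_shift (s y : ℝ) (j : ℕ) :
    HasSum (fun m : ℕ => (-1) ^ m / (m.factorial : ℝ) *
        (s ^ (m + j) * Polynomial.aeval y (Polynomial.hermite (m + j))))
      (s ^ j * Polynomial.aeval (y + s) (Polynomial.hermite j) *
        Real.exp (-(y * s) - s ^ 2 / 2)) := by
  have hcast (u : ℝ) (n : ℕ) : ((Polynomial.aeval u (Polynomial.hermite n) : ℝ) : ℂ) =
      Polynomial.aeval (u : ℂ) (Polynomial.hermite n) :=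
    (Polynomial.aeval_algebraMap_apply ℂ u (Polynomial.hermite n)).symm
  have h := Complex.hasSum_taylorSeries_of_entire
    (fun t => (hasDerivAt_hermiteGen s y j t).differentiableAt) 0 (-1)
  rw [← Complex.hasSum_ofReal]
  convert! h using 1
  · ext m
    rw [iteratedDeriv_hermiteGen]
    simp [hermiteGen, hcast]
    ring
  · simp [hermiteGen, hcast]

theorem charlier_natCast_div {a : ℝ} (ha : a ≠ 0) (n k : ℕ) :
    charlier a n k / (a ^ n * n.factorial) =
      ∑ j ∈ Finset.range (k + 1), if j ≤ n then
        (k.choose j : ℝ) / a ^ j * ((-1) ^ (n - j) / ((n - j).factorial : ℝ)) else 0 := by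
  have hterm (j : ℕ) (hj : j ≤ n) :
      (-1 : ℝ) ^ (n - j) * (n.choose j : ℝ) * (∏ i ∈ Finset.range j, ((k : ℝ) - (i : ℝ))) / a ^ j
        / n.factorial =
      (k.choose j : ℝ) / a ^ j * ((-1) ^ (n - j) / ((n - j).factorial : ℝ)) := by
    rw [← descPochhammer_eval_eq_prod_range, descPochhammer_eval_eq_descFactorial,
      Nat.descFactorial_eq_factorial_mul_choose, ← Nat.choose_mul_factorial_mul_factorial hj]
    have hc : (n.choose j : ℝ) ≠ 0 := mod_cast (Nat.choose_pos hj).ne'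
    have hf : (j.factorial : ℝ) ≠ 0 := mod_cast j.factorial_ne_zero
    have hg : ((n - j).factorial : ℝ) ≠ 0 := mod_cast (n - j).factorial_ne_zero
    push_cast
    field_simp
  rw [charlier, mul_div_mul_left _ _ (pow_ne_zero n ha), Finset.sum_div]
  trans ∑ j ∈ Finset.range (max n k + 1), if j ≤ n then
        (k.choose j : ℝ) / a ^ j * ((-1) ^ (n - j) / ((n - j).factorial : ℝ)) else 0
  · rw [← Finset.sum_subset (Finset.range_subset_range.2
      (Nat.succ_le_succ (le_max_left n k)))]
    · refine Finset.sum_congr rfl fun j hj => ?_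
      have hj' := Nat.lt_succ_iff.mp (Finset.mem_range.mp hj)
      rw [if_pos hj', hterm j hj']
    · intro j _ hj
      exact if_neg fun h => hj (Finset.mem_range.mpr (Nat.lt_succ_of_le h))
  · refine (Finset.sum_subset (Finset.range_subset_range.2
      (Nat.succ_le_succ (le_max_right n k))) fun j _ hj => ?_).symm
    rw [Nat.choose_eq_zero_of_lt (by simpa using hj)]
    simp

/-- The Hermite–Charlier bilinear identity
`∑_{n≥0} Hₙᵃ(x) Cₙᵃ(k)/(aⁿ n!) = e^{−a/2 − x} Hₖᵃ(x + 2a)/aᵏ` for all real `x`,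
`k ∈ ℕ`, `a > 0`; the series converges (absolutely, hence in `L²(ℝ, N(0,a))`). -/
theorem hermite_charlier_identity (a : ℝ) (ha : 0 < a) (k : ℕ) (x : ℝ) :
    Summable (fun n : ℕ =>
      hermiteScaled a n x * charlier a n (k : ℝ) / (a ^ n * (n.factorial : ℝ))) ∧
    ∑' n : ℕ, hermiteScaled a n x * charlier a n (k : ℝ) / (a ^ n * (n.factorial : ℝ))
      = Real.exp (-a / 2 - x) * hermiteScaled a k (x + 2 * a) / a ^ k := by
  have hs : 0 < √a := Real.sqrt_pos.mpr ha
  have hsq : √a ^ 2 = a := Real.sq_sqrt ha.le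
  have hH (j : ℕ) : HasSum (fun n : ℕ => if j ≤ n then
      (k.choose j : ℝ) / a ^ j * ((-1) ^ (n - j) / ((n - j).factorial : ℝ)) * hermiteScaled a n x
      else 0)
      ((k.choose j : ℝ) / a ^ j * (√a ^ j *
        Polynomial.aeval (x / √a + √a) (Polynomial.hermite j) * Real.exp (-a / 2 - x))) := by
    rw [← (add_left_injective j).hasSum_iff]
    · convert! (hasSum_hermite_shift (√a) (x / √a) j).mul_left ((k.choose j : ℝ) / a ^ j) using 1
      · ext m
        simp [hermiteScaled, mul_assoc]
      · rw [div_mul_cancel₀ _ hs.ne', hsq]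
        ring_nf
    · intro n hn
      exact if_neg fun h => hn ⟨n - j, Nat.sub_add_cancel h⟩
  have hsum : HasSum (fun n : ℕ =>
      hermiteScaled a n x * charlier a n (k : ℝ) / (a ^ n * (n.factorial : ℝ)))
      (Real.exp (-a / 2 - x) * hermiteScaled a k (x + 2 * a) / a ^ k) := by
    convert! hasSum_sum fun j (_ : j ∈ Finset.range (k + 1)) => hH j using 1
    · ext n
      rw [mul_div_assoc, charlier_natCast_div ha.ne', Finset.mul_sum]
      refine Finset.sum_congr rfl fun j _ => ?_
      split_ifs <;> ring
    · have hx : (x + 2 * a) / √a = x / √a + √a + √a := by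
        rw [← hsq]
        field_simp
        rw [Real.sqrt_sq hs.le]
        ring
      rw [hermiteScaled, hx, aeval_hermite_add, Finset.mul_sum, Finset.mul_sum, Finset.sum_div]
      refine Finset.sum_congr rfl fun j hj => ?_
      obtain ⟨i, rfl⟩ := Nat.exists_eq_add_of_le (Nat.lt_succ_iff.mp (Finset.mem_range.mp hj))
      have hpow : √a ^ (j + i) * √a ^ i = √a ^ j * a ^ i := by
        rw [pow_add, mul_assoc, ← mul_pow, Real.mul_self_sqrt ha.le]
      rw [Nat.add_sub_cancel_left, div_eq_iff (pow_ne_zero _ ha.ne'), pow_add a]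
      generalize Polynomial.aeval (x / √a + √a) (Polynomial.hermite j) = p
      have ha' : a ^ j ≠ 0 := pow_ne_zero _ ha.ne'
      rw [div_mul_eq_mul_div, div_mul_eq_mul_div, eq_div_iff ha']
      linear_combination Real.exp (-a / 2 - x) * ((j + i).choose j : ℝ) * p * a ^ j * hpow
  exact ⟨hsum.summable, hsum.tsum_eq⟩
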